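/- Let P ∈ D_n be a Dyck path with P ≠ (ud)^n, and suppose that the intervals in F_P are pairwise disjoint. Then the sum of the heights of the peaks of P equals ‖F_P‖ + |F_P| + ‖F_{∼P}‖ − |F_{∼P}*|, which also equals (n−1) + |F_P| − |F_{∼P}*|. -/

import Mathlib

/-- A Dyck path of semilength `n`, encoded by its height function:
`h t` is the height after the first `t` steps (number of `u`'s minus number of `d`'s
among the first `t` letters). -/
structure DyckPath (n : ℕ) where
  h : ℕ → ℤ
  init : h 0 = 0
  tail : ∀ t, 2 * n ≤ t → h t = 0
  step : ∀ t, t < 2 * n → h (t + 1) = h t + 1 ∨ h (t + 1) = h t - 1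
  nonneg : ∀ t, 0 ≤ h t

/-- The partial order on Dyck paths: `P ≤ Q` iff the height of `P` is pointwise
at most the height of `Q`. -/
def dle {n : ℕ} (P Q : DyckPath n) : Prop := ∀ t, P.h t ≤ Q.h t

/-- `R` is the relative pseudocomplement `P ⇝ Q` in the Dyck algebra `𝔇_n`:
`R` is the greatest Dyck path such that `P ∧ R ≤ Q` (meet being the pointwise
minimum of height functions). -/
def IsRelPseudo {n : ℕ} (P Q R : DyckPath n) : Prop :=
  (∀ t, min (P.h t) (R.h t) ≤ Q.h t) ∧
  ∀ S : DyckPath n, (∀ t, min (P.h t) (S.h t) ≤ Q.h t) → dle S R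

/-- The height function of the minimum Dyck path `(ud)^n`. -/
def minH (n : ℕ) (t : ℕ) : ℤ := if 2 * n ≤ t then 0 else (t : ℤ) % 2

/-- The minimum Dyck path `(ud)^n` of semilength `n`. -/
def minPath (n : ℕ) : DyckPath n where
  h := minH n
  init := by unfold minH; split_ifs <;> omega
  tail := by intro t ht; unfold minH; split_ifs <;> omega
  step := by intro t ht; unfold minH; split_ifs <;> omega
  nonneg := by intro t; unfold minH; split_ifs <;> omega

/-- `R` is the pseudocomplement `∼P = P ⇝ 0` in the Dyck algebra `𝔇_n`. -/
def IsPseudo {n : ℕ} (P R : DyckPath n) : Prop := IsRelPseudo P (minPath n) R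

/-- `x` is a return of `P`: an even abscissa `2 ≤ x ≤ 2n` where the path touches the `x`-axis. -/
def IsReturn {n : ℕ} (P : DyckPath n) (x : ℕ) : Prop :=
  Even x ∧ 2 ≤ x ∧ x ≤ 2 * n ∧ P.h x = 0

/-- Every factor of `P` (portion between two consecutive points of the path on the
`x`-axis) is a pyramid `u^k d^k`, i.e. between two consecutive zeroes `a < b` of the
height function the height is `min (t - a) (b - t)`. -/
def FactorsArePyramids {n : ℕ} (P : DyckPath n) : Prop :=
  ∀ a b : ℕ, a < b → b ≤ 2 * n → P.h a = 0 → P.h b = 0 →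
    (∀ c, a < c → c < b → 0 < P.h c) →
    ∀ t, a ≤ t → t ≤ b → P.h t = min ((t : ℤ) - (a : ℤ)) ((b : ℤ) - (t : ℤ))

/-- The height function of the join-irreducible Dyck path `J_{[a,b]}` of semilength `n`
(`1 ≤ a ≤ b ≤ n−1`): all factors are hills except a single pyramid `u^{b−a+2} d^{b−a+2}`
occupying abscissas `2a−2` through `2b+2`. -/
def heightJ (a b t : ℕ) : ℤ :=
  if 2 * (a : ℤ) - 2 ≤ (t : ℤ) ∧ (t : ℤ) ≤ 2 * (b : ℤ) + 2 then
    min ((t : ℤ) - (2 * (a : ℤ) - 2)) (2 * (b : ℤ) + 2 - (t : ℤ))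
  else (t : ℤ) % 2

/-- `J_{[a,b]} ≤ P` in the Dyck lattice: the height of the join-irreducible `J_{[a,b]}`
is pointwise below the height of `P`. -/
def JIle {n : ℕ} (P : DyckPath n) (a b : ℕ) : Prop :=
  ∀ t, t ≤ 2 * n → heightJ a b t ≤ P.h t

/-- `[a,b]` is an interval of `[n−1] = {1, …, n−1}`. -/
def validIvl (n a b : ℕ) : Prop := 1 ≤ a ∧ a ≤ b ∧ b ≤ n - 1

/-- `F_P`: the antichain of all inclusion-maximal intervals `[a,b] ⊆ [n−1]`
with `J_{[a,b]} ≤ P` (intervals encoded as pairs `(a,b)`). -/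
def FP {n : ℕ} (P : DyckPath n) : Set (ℕ × ℕ) :=
  {p | validIvl n p.1 p.2 ∧ JIle P p.1 p.2 ∧
    ∀ q : ℕ × ℕ, validIvl n q.1 q.2 → JIle P q.1 q.2 →
      Set.Icc p.1 p.2 ⊆ Set.Icc q.1 q.2 → q = p}

/-- `‖F_P‖ = |⋃_{I ∈ F_P} I|`. -/
noncomputable def normFP {n : ℕ} (P : DyckPath n) : ℕ :=
  (⋃ p ∈ FP P, Set.Icc p.1 p.2).ncard

/-- `F_P*`: the set of internal intervals of `F_P`, those containing neither `1` nor `n−1`. -/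
def FPstar {n : ℕ} (P : DyckPath n) : Set (ℕ × ℕ) :=
  {p ∈ FP P | 1 ∉ Set.Icc p.1 p.2 ∧ n - 1 ∉ Set.Icc p.1 p.2}

/-- `P` has a peak with apex at abscissa `t`: the `t`-th letter of `P` is `u` and the
`(t+1)`-st is `d`. -/
def IsPeak {n : ℕ} (P : DyckPath n) (t : ℕ) : Prop :=
  1 ≤ t ∧ t + 1 ≤ 2 * n ∧ P.h t = P.h (t - 1) + 1 ∧ P.h (t + 1) = P.h t - 1

/-- `P` has a hill (peak at height 1, i.e. lying on the `x`-axis) with apex at abscissa `t`. -/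
def IsHill {n : ℕ} (P : DyckPath n) (t : ℕ) : Prop :=
  IsPeak P t ∧ P.h (t - 1) = 0

namespace DyckPath

variable {n : ℕ}

theorem h_emod_two (P : DyckPath n) (t : ℕ) (ht : t ≤ 2 * n) : P.h t % 2 = (t : ℤ) % 2 := by
  induction t with
  | zero => simp [P.init]
  | succ t ih =>
    have := ih (by omega)
    rcases P.step t (by omega) with h | h <;> rw [h] <;> push_cast <;> omega

theorem h_step_le (P : DyckPath n) (t : ℕ) : P.h (t + 1) ≤ P.h t + 1 ∧ P.h t ≤ P.h (t + 1) + 1 := by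
  rcases lt_or_ge t (2 * n) with ht | ht
  · rcases P.step t ht with h | h <;> omega
  · have := P.tail t ht
    have := P.tail (t + 1) (by omega)
    omega

theorem h_lipschitz (P : DyckPath n) (s k : ℕ) :
    P.h (s + k) ≤ P.h s + k ∧ P.h s ≤ P.h (s + k) + k := by
  induction k with
  | zero => simp
  | succ k ih =>
    have := P.h_step_le (s + k)
    rw [← add_assoc]
    push_cast
    omega

theorem h_le_self (P : DyckPath n) (t : ℕ) : P.h t ≤ t := by
  have := (P.h_lipschitz 0 t).1
  rw [P.init] at this
  simpa using this

theorem h_le_two_mul_sub (P : DyckPath n) (t : ℕ) (ht : t ≤ 2 * n) : P.h t ≤ 2 * n - t := by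
  obtain ⟨k, hk⟩ := Nat.exists_eq_add_of_le ht
  have h1 := (P.h_lipschitz t k).2
  rw [← hk, P.tail _ le_rfl] at h1
  omega

theorem jile_iff (P : DyckPath n) {a b : ℕ} (hv : validIvl n a b) :
    JIle P a b ↔ (b : ℤ) - a + 2 ≤ P.h (a + b) := by
  obtain ⟨h1, h2, h3⟩ := hv
  constructor
  · intro h
    have := h (a + b) (by omega)
    unfold heightJ at this
    split_ifs at this <;> push_cast at * <;> omega
  · intro h t ht
    have hpar := P.h_emod_two t ht
    have hnn := P.nonneg t
    have hl : P.h (a + b) ≤ P.h t + |(a + b : ℤ) - t| := by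
      rcases le_total t (a + b) with hc | hc
      · obtain ⟨k, hk⟩ := Nat.exists_eq_add_of_le hc
        have := (P.h_lipschitz t k).1
        rw [hk, abs_of_nonneg (by omega)]
        omega
      · obtain ⟨k, hk⟩ := Nat.exists_eq_add_of_le hc
        have := (P.h_lipschitz (a + b) k).2
        rw [hk, abs_of_nonpos (by omega)]
        rw [← hk] at this ⊢
        omega
    unfold heightJ
    split_ifs
    · rcases abs_cases ((a + b : ℤ) - t) with hc | hc <;> omega
    · omega

theorem jile_mono (P : DyckPath n) {a b a' b' : ℕ} (ha : a' ≤ a) (hb : b ≤ b')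
    (h : JIle P a' b') : JIle P a b := by
  intro t ht
  have h1 := h t ht
  have hpar := P.h_emod_two t ht
  have hnn := P.nonneg t
  unfold heightJ at *
  split_ifs at * <;> omega

theorem exists_mem_FP (P : DyckPath n) {a b : ℕ} (hv : validIvl n a b) (h : JIle P a b) :
    ∃ p ∈ FP P, p.1 ≤ a ∧ b ≤ p.2 := by
  classical
  let S := ((Finset.range n) ×ˢ (Finset.range n)).filter
    (fun p : ℕ × ℕ => validIvl n p.1 p.2 ∧ JIle P p.1 p.2 ∧ p.1 ≤ a ∧ b ≤ p.2)
  have hS : ∀ p : ℕ × ℕ,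
      p ∈ S ↔ validIvl n p.1 p.2 ∧ JIle P p.1 p.2 ∧ p.1 ≤ a ∧ b ≤ p.2 := by
    intro p
    simp only [S, Finset.mem_filter, Finset.mem_product, Finset.mem_range, and_iff_right_iff_imp]
    rintro ⟨⟨h1, h2, h3⟩, -⟩
    omega
  obtain ⟨p, hp, hmax⟩ := S.exists_max_image (fun p => p.2 - p.1)
    ⟨(a, b), (hS _).2 ⟨hv, h, le_rfl, le_rfl⟩⟩
  obtain ⟨hpv, hpj, hpa, hpb⟩ := (hS p).1 hp
  refine ⟨p, ⟨hpv, hpj, fun q hqv hqj hsub => ?_⟩, hpa, hpb⟩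
  obtain ⟨h1, h2⟩ := (Set.Icc_subset_Icc_iff hpv.2.1).1 hsub
  have := hmax q ((hS q).2 ⟨hqv, hqj, by omega, by omega⟩)
  have := hpv.2.1
  have := hqv.2.1
  ext <;> omega

theorem iUnion_FP (P : DyckPath n) :
    (⋃ p ∈ FP P, Set.Icc p.1 p.2) = {i | validIvl n i i ∧ JIle P i i} := by
  ext i
  simp only [Set.mem_iUnion, Set.mem_Icc, exists_prop, Set.mem_ofPred_eq]
  constructor
  · rintro ⟨p, ⟨⟨h1, h2, h3⟩, hj, -⟩, h4, h5⟩
    exact ⟨⟨by omega, le_rfl, by omega⟩, P.jile_mono h4 h5 hj⟩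
  · rintro ⟨hv, hj⟩
    exact P.exists_mem_FP hv hj

theorem jile_self_iff (P : DyckPath n) {i : ℕ} (hv : validIvl n i i) :
    JIle P i i ↔ P.h (2 * i) ≠ 0 := by
  rw [P.jile_iff hv, ← two_mul]
  have h1 := P.nonneg (2 * i)
  have h2 := P.h_emod_two (2 * i) (by have := hv.2.2; omega)
  push_cast at h2
  omega

theorem mem_FP_iff (P : DyckPath n) (a b : ℕ) :
    (a, b) ∈ FP P ↔ a ≤ b ∧ IsPeak P (a + b) ∧ P.h (a + b) = b - a + 2 := by
  constructor
  · rintro ⟨hv, hj, hmax⟩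
    obtain ⟨h1, h2, h3⟩ := id hv
    simp only at h1 h2 h3
    have hj' := (P.jile_iff hv).1 hj
    simp only at hj'
    have hs := P.h_step_le (a + b - 1)
    rw [show a + b - 1 + 1 = a + b by omega] at hs
    have hs' := P.h_step_le (a + b)
    have hp := P.h_emod_two (a + b) (by omega)
    have hp1 := P.h_emod_two (a + b - 1) (by omega)
    have hp2 := P.h_emod_two (a + b + 1) (by omega)
    have hl := P.h_le_self (a + b)
    have hl1 := P.h_le_self (a + b - 1)
    have hr := P.h_le_two_mul_sub (a + b) (by omega)
    have hr1 := P.h_le_two_mul_sub (a + b + 1) (by omega)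
    have hA : P.h (a + b - 1) ≤ b - a + 1 := by
      by_contra hc
      rcases eq_or_lt_of_le h1 with ha | ha
      · omega
      · have hv' : validIvl n (a - 1) b := ⟨by omega, by omega, h3⟩
        have hJ : JIle P (a - 1) b := by
          rw [P.jile_iff hv', show a - 1 + b = a + b - 1 by omega]
          omega
        have := hmax (a - 1, b) hv' hJ (Set.Icc_subset_Icc (by simp) le_rfl)
        simp only [Prod.mk.injEq] at this
        omega
    have hB : P.h (a + b + 1) ≤ b - a + 1 := by
      by_contra hc
      rcases eq_or_lt_of_le h3 with hb | hb
      · omega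
      · have hv' : validIvl n a (b + 1) := ⟨by omega, by omega, by omega⟩
        have hJ : JIle P a (b + 1) := by
          rw [P.jile_iff hv', ← add_assoc]
          omega
        have := hmax (a, b + 1) hv' hJ (Set.Icc_subset_Icc le_rfl (by simp))
        simp only [Prod.mk.injEq] at this
        omega
    refine ⟨h2, ⟨by omega, by omega, by omega, by omega⟩, by omega⟩
  · rintro ⟨hab, ⟨p1, p2, p3, p4⟩, hh⟩
    have hl := P.h_le_self (a + b)
    have hr := P.h_le_two_mul_sub (a + b) (by omega)
    have hv : validIvl n a b := ⟨by omega, hab, by omega⟩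
    refine ⟨hv, (P.jile_iff hv).2 hh.ge, ?_⟩
    rintro ⟨a', b'⟩ hqv hqj hsub
    obtain ⟨h1, h2⟩ := (Set.Icc_subset_Icc_iff (show a ≤ b from hab)).1 hsub
    simp only at h1 h2 hqv hqj
    obtain ⟨q1, q2, q3⟩ := hqv
    have j1 := hqj (a + b - 1) (by omega)
    have j2 := hqj (a + b + 1) (by omega)
    unfold heightJ at j1 j2
    simp only [Prod.mk.injEq]
    constructor
    · split_ifs at j1 <;> omega
    · split_ifs at j2 <;> omega

theorem eq_minPath_of_forall (P : DyckPath n)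
    (hz : ∀ i, 1 ≤ i → i ≤ n - 1 → P.h (2 * i) = 0) : P = minPath n := by
  have hz' : ∀ i, P.h (2 * i) = 0 := by
    intro i
    rcases Nat.eq_zero_or_pos i with h0 | h0
    · simp [h0, P.init]
    rcases le_or_gt n i with h1 | h1
    · exact P.tail _ (by omega)
    · exact hz i h0 (by omega)
  have hh : P.h = (minPath n).h := by
    funext t
    change P.h t = minH n t
    unfold minH
    split_ifs with ht
    · exact P.tail t ht
    · have hp := P.h_emod_two t (by omega)
      have hn := P.nonneg t
      have h0 := hz' (t / 2)
      rcases Nat.mod_two_eq_zero_or_one t with h | h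
      · rw [show 2 * (t / 2) = t by omega] at h0
        omega
      · have hs := P.h_step_le (2 * (t / 2))
        rw [show 2 * (t / 2) + 1 = t by omega] at hs
        omega
  cases P
  cases hh
  rfl

/-- The join-irreducible path `J_{[a,b]}` as a Dyck path. -/
def joinIrred (n a b : ℕ) (hv : validIvl n a b) : DyckPath n where
  h t := if 2 * n ≤ t then 0 else heightJ a b t
  init := by
    obtain ⟨h1, h2, h3⟩ := hv
    unfold heightJ; split_ifs <;> omega
  tail := by intro t ht; simp [ht]
  step := by
    intro t ht
    obtain ⟨h1, h2, h3⟩ := hv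
    unfold heightJ; split_ifs <;> push_cast at * <;> omega
  nonneg := by
    intro t
    obtain ⟨h1, h2, h3⟩ := hv
    unfold heightJ; split_ifs <;> omega

theorem jile_pseudo_iff {P R : DyckPath n} (hR : IsPseudo P R) {a b : ℕ}
    (hv : validIvl n a b) : JIle R a b ↔ ∀ i, a ≤ i → i ≤ b → P.h (2 * i) = 0 := by
  obtain ⟨v1, v2, v3⟩ := id hv
  constructor
  · intro h i hi hi'
    have hvi : validIvl n i i := ⟨by omega, le_rfl, by omega⟩
    have h1 := (R.jile_self_iff hvi).1 (R.jile_mono hi hi' h)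
    have h2 := hR.1 (2 * i)
    change _ ≤ minH n (2 * i) at h2
    have h3 := R.nonneg (2 * i)
    have h4 := P.nonneg (2 * i)
    unfold minH at h2
    split_ifs at h2 <;> push_cast at h2 <;> omega
  · intro h
    have key : ∀ t, min (P.h t) ((joinIrred n a b hv).h t) ≤ (minPath n).h t := by
      intro t
      change min (P.h t) (if 2 * n ≤ t then 0 else heightJ a b t) ≤ minH n t
      unfold minH
      split_ifs with ht
      · exact min_le_right _ _
      · unfold heightJ
        split_ifs with hc
        · rcases Nat.mod_two_eq_zero_or_one t with hm | hm
          · rcases le_or_gt a (t / 2) with ha | ha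
            · rcases le_or_gt (t / 2) b with hb | hb
              · have := h (t / 2) ha hb
                rw [show 2 * (t / 2) = t by omega] at this
                omega
              · omega
            · omega
          · rcases le_or_gt a (t / 2) with ha | ha
            · rcases le_or_gt (t / 2) b with hb | hb
              · have := h (t / 2) ha hb
                have hs := P.h_step_le (2 * (t / 2))
                rw [show 2 * (t / 2) + 1 = t by omega] at hs
                omega
              · omega
            · omega
        · exact min_le_right _ _
    intro t ht
    have hd : (if 2 * n ≤ t then 0 else heightJ a b t) ≤ R.h t := hR.2 _ key t
    split_ifs at hd with hc
    · have : t = 2 * n := by omega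
      unfold heightJ
      split_ifs <;> omega
    · exact hd

theorem mem_FPstar_pseudo_iff {P R : DyckPath n} (hR : IsPseudo P R) (a b : ℕ) :
    (a, b) ∈ FPstar R ↔ validIvl n a b ∧ (∀ i, a ≤ i → i ≤ b → P.h (2 * i) = 0) ∧
      P.h (2 * (a - 1)) ≠ 0 ∧ P.h (2 * (b + 1)) ≠ 0 := by
  constructor
  · rintro ⟨⟨hv, hj, hmax⟩, h1, h2⟩
    simp only at hv hj hmax h1 h2
    obtain ⟨v1, v2, v3⟩ := id hv
    simp only [Set.mem_Icc] at h1 h2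
    have hz := (jile_pseudo_iff hR hv).1 hj
    refine ⟨hv, hz, fun hc => ?_, fun hc => ?_⟩
    · have hv' : validIvl n (a - 1) b := ⟨by omega, by omega, by omega⟩
      have := hmax (a - 1, b) hv' ((jile_pseudo_iff hR hv').2 fun i hi hi' => by
        rcases eq_or_lt_of_le hi with h | h
        · rwa [← h]
        · exact hz i (by omega) hi') (Set.Icc_subset_Icc (by simp) le_rfl)
      simp only [Prod.mk.injEq] at this
      omega
    · have hv' : validIvl n a (b + 1) := ⟨by omega, by omega, by omega⟩
      have := hmax (a, b + 1) hv' ((jile_pseudo_iff hR hv').2 fun i hi hi' => by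
        rcases eq_or_lt_of_le hi' with h | h
        · rwa [h]
        · exact hz i hi (by omega)) (Set.Icc_subset_Icc le_rfl (by simp))
      simp only [Prod.mk.injEq] at this
      omega
  · rintro ⟨hv, hz, hA, hB⟩
    obtain ⟨v1, v2, v3⟩ := id hv
    have ha : a ≠ 1 := by
      rintro rfl
      exact hA P.init
    have hb : b + 1 < n := by
      by_contra hc
      exact hB (P.tail _ (by omega))
    refine ⟨⟨hv, (jile_pseudo_iff hR hv).2 hz, ?_⟩, ?_, ?_⟩
    · rintro ⟨a', b'⟩ hqv hqj hsub
      obtain ⟨h1, h2⟩ := (Set.Icc_subset_Icc_iff (show a ≤ b from v2)).1 hsub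
      simp only at h1 h2 hqv hqj
      have hz' := (jile_pseudo_iff hR hqv).1 hqj
      simp only [Prod.mk.injEq]
      constructor
      · by_contra hc
        exact hA (hz' _ (by omega) (by omega))
      · by_contra hc
        exact hB (hz' _ (by omega) (by omega))
    · simp only [Set.mem_Icc]; omega
    · simp only [Set.mem_Icc]; omega

theorem finite_FP (P : DyckPath n) : (FP P).Finite := by
  refine ((Set.finite_Iic n).prod (Set.finite_Iic n)).subset ?_
  rintro ⟨a, b⟩ ⟨⟨h1, h2, h3⟩, -⟩
  simp only [Set.mem_prod, Set.mem_Iic] at *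
  omega

open Finset in
theorem sum_card_FP (P : DyckPath n)
    (hdisj : ∀ p ∈ FP P, ∀ q ∈ FP P, p ≠ q → Set.Icc p.1 p.2 ∩ Set.Icc q.1 q.2 = ∅) :
    ∑ p ∈ P.finite_FP.toFinset, (p.2 + 1 - p.1) = normFP P := by
  classical
  have hU : (⋃ p ∈ FP P, Set.Icc p.1 p.2) =
      ((P.finite_FP.toFinset.biUnion fun p => Finset.Icc p.1 p.2 : Finset ℕ) : Set ℕ) := by
    ext i
    simp
  rw [normFP, hU, Set.ncard_coe_finset, Finset.card_biUnion]
  · simp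
  · intro p hp q hq hpq
    rw [Finset.mem_coe, Set.Finite.mem_toFinset] at hp hq
    rw [Function.onFun, ← Finset.disjoint_coe, Set.disjoint_iff_inter_eq_empty]
    simpa using hdisj p hp q hq hpq

open Finset in
theorem normFP_eq_card (P : DyckPath n) :
    normFP P = #{i ∈ Icc 1 (n - 1) | P.h (2 * i) ≠ 0} := by
  rw [normFP, P.iUnion_FP, ← Set.ncard_coe_finset]
  congr 1
  ext i
  simp only [Set.mem_ofPred_eq, coe_filter, Finset.mem_Icc]
  constructor
  · rintro ⟨hv, hj⟩
    exact ⟨⟨hv.1, hv.2.2⟩, (P.jile_self_iff hv).1 hj⟩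
  · rintro ⟨⟨h1, h2⟩, h3⟩
    have hv : validIvl n i i := ⟨h1, le_rfl, h2⟩
    exact ⟨hv, (P.jile_self_iff hv).2 h3⟩

open Finset in
theorem normFP_pseudo_eq_card {P R : DyckPath n} (hR : IsPseudo P R) :
    normFP R = #{i ∈ Icc 1 (n - 1) | P.h (2 * i) = 0} := by
  rw [normFP_eq_card]
  congr 1
  refine filter_congr fun i hi => ?_
  rw [Finset.mem_Icc] at hi
  have hv : validIvl n i i := ⟨hi.1, le_rfl, hi.2⟩
  rw [← R.jile_self_iff hv, jile_pseudo_iff hR hv]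
  exact ⟨fun h => h i le_rfl le_rfl, fun h j h1 h2 => by rwa [le_antisymm h2 h1]⟩

open Finset in
/-- Away from a fixed `m` with `P.h (2 * m) ≠ 0`, each zero `2 * z` of `P` either borders a hill
on the side opposite to `m`, or is the end of an internal interval of `F_{∼P}` on that side. -/
theorem card_hills_add_card_FPstar {P R : DyckPath n} (hP : P ≠ minPath n)
    (hR : IsPseudo P R) :
    #{i ∈ range n | P.h (2 * i) = 0 ∧ P.h (2 * (i + 1)) = 0} + (FPstar R).ncard =
      normFP R := by
  classical
  obtain ⟨m, m1, m2, hm⟩ : ∃ m, 1 ≤ m ∧ m ≤ n - 1 ∧ P.h (2 * m) ≠ 0 := by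
    by_contra! hc
    exact hP (P.eq_minPath_of_forall hc)
  have hfin : (FPstar R).Finite := R.finite_FP.subset fun p hp => hp.1
  have hmem : ∀ p : ℕ × ℕ, p ∈ FPstar R → (p.2 < m ∨ m < p.1) := by
    rintro ⟨a, b⟩ hp
    by_contra! hc
    exact hm (((mem_FPstar_pseudo_iff hR a b).1 hp).2.1 m hc.2 hc.1)
  let f : ℕ → ℕ := fun i => if i < m then i + 1 else i
  let g : ℕ × ℕ → ℕ := fun p => if p.2 < m then p.1 else p.2
  set H := {i ∈ range n | P.h (2 * i) = 0 ∧ P.h (2 * (i + 1)) = 0} with hH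
  have hHm : ∀ i ∈ H, P.h (2 * i) = 0 ∧ P.h (2 * (i + 1)) = 0 ∧ i < n ∧ i ≠ m ∧ i + 1 ≠ m := by
    intro i hi
    simp only [hH, mem_filter, mem_range] at hi
    refine ⟨hi.2.1, hi.2.2, hi.1, ?_, ?_⟩
    · rintro rfl; exact hm hi.2.1
    · rintro rfl; exact hm hi.2.2
  have hf : Set.InjOn f H := by
    intro i hi j hj hij
    have := hHm i hi
    have := hHm j hj
    simp only [f] at hij
    split_ifs at hij <;> omega
  have hg : Set.InjOn g hfin.toFinset := by
    rintro ⟨a, b⟩ hp ⟨a', b'⟩ hq hpq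
    rw [Finset.mem_coe, Set.Finite.mem_toFinset] at hp hq
    have d1 := hmem _ hp
    have d2 := hmem _ hq
    obtain ⟨⟨v1, v2, v3⟩, z, e1, e2⟩ := (mem_FPstar_pseudo_iff hR _ _).1 hp
    obtain ⟨⟨v1', v2', v3'⟩, z', e1', e2'⟩ := (mem_FPstar_pseudo_iff hR _ _).1 hq
    have n1 : ¬ (a ≤ b' + 1 ∧ b' + 1 ≤ b) := fun h => e2' (z _ h.1 h.2)
    have n2 : ¬ (a' ≤ b + 1 ∧ b + 1 ≤ b') := fun h => e2 (z' _ h.1 h.2)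
    have n3 : ¬ (a ≤ a' - 1 ∧ a' - 1 ≤ b) := fun h => e1' (z _ h.1 h.2)
    have n4 : ¬ (a' ≤ a - 1 ∧ a - 1 ≤ b') := fun h => e1 (z' _ h.1 h.2)
    simp only [g] at hpq d1 d2
    simp only [Prod.mk.injEq]
    split_ifs at hpq <;> omega
  have hd : Disjoint (H.image f) (hfin.toFinset.image g) := by
    rw [Finset.disjoint_left]
    intro x hx hy
    rw [Finset.mem_image] at hx hy
    obtain ⟨i, hi, rfl⟩ := hx
    obtain ⟨⟨a, b⟩, hp, hpi⟩ := hy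
    rw [Set.Finite.mem_toFinset] at hp
    have d1 := hmem _ hp
    obtain ⟨⟨v1, v2, v3⟩, z, e1, e2⟩ := (mem_FPstar_pseudo_iff hR _ _).1 hp
    have d2 := hHm i hi
    have n1 : i ≠ a - 1 := by rintro rfl; exact e1 d2.1
    have n2 : i ≠ b := by rintro rfl; exact e2 d2.2.1
    simp only [f, g] at hpi d1
    split_ifs at hpi <;> omega
  have hun : ({i ∈ Icc 1 (n - 1) | P.h (2 * i) = 0} : Finset ℕ) =
      H.image f ∪ hfin.toFinset.image g := by
    ext z
    simp only [mem_filter, Finset.mem_Icc, Finset.mem_union, Finset.mem_image,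
      Set.Finite.mem_toFinset]
    constructor
    · rintro ⟨⟨z1, z2⟩, hz⟩
      have hzm : z ≠ m := by rintro rfl; exact hm hz
      rcases lt_or_gt_of_ne hzm with hlt | hgt
      · by_cases hz' : P.h (2 * (z - 1)) = 0
        · refine Or.inl ⟨z - 1, ?_, ?_⟩
          · simp only [hH, mem_filter, mem_range]
            refine ⟨by omega, hz', ?_⟩
            rwa [show z - 1 + 1 = z by omega]
          · simp only [f]
            rw [if_pos (by omega)]
            omega
        · have hex : ∃ k, z < k ∧ P.h (2 * k) ≠ 0 := ⟨m, hlt, hm⟩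
          have hk := Nat.find_spec hex
          have hmin : ∀ j < Nat.find hex, ¬ (z < j ∧ P.h (2 * j) ≠ 0) :=
            fun j hj => Nat.find_min hex hj
          have hkm : Nat.find hex ≤ m := Nat.find_min' hex ⟨hlt, hm⟩
          generalize Nat.find hex = k at hk hmin hkm
          refine Or.inr ⟨(z, k - 1), (mem_FPstar_pseudo_iff hR _ _).2
            ⟨⟨z1, by omega, by omega⟩, fun i hi hi' => ?_, hz', ?_⟩, ?_⟩
          · rcases eq_or_lt_of_le hi with h | h
            · rwa [← h]
            · by_contra hc
              exact hmin i (by omega) ⟨h, hc⟩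
          · rw [show k - 1 + 1 = k by omega]
            exact hk.2
          · simp only [g]
            rw [if_pos (by omega)]
      · by_cases hz' : P.h (2 * (z + 1)) = 0
        · refine Or.inl ⟨z, ?_, ?_⟩
          · simp only [hH, mem_filter, mem_range]
            exact ⟨by omega, hz, hz'⟩
          · simp only [f]
            rw [if_neg (by omega)]
        · have hex : ∃ k, k < z ∧ P.h (2 * (z - 1 - k)) ≠ 0 ∧ k ≤ z - 1 - m :=
            ⟨z - 1 - m, by omega, by rwa [show z - 1 - (z - 1 - m) = m by omega], le_rfl⟩
          have hk := Nat.find_spec hex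
          have hmin : ∀ j < Nat.find hex,
              ¬ (j < z ∧ P.h (2 * (z - 1 - j)) ≠ 0 ∧ j ≤ z - 1 - m) :=
            fun j hj => Nat.find_min hex hj
          generalize Nat.find hex = k at hk hmin
          refine Or.inr ⟨(z - k, z), (mem_FPstar_pseudo_iff hR _ _).2
            ⟨⟨by omega, by omega, by omega⟩, fun i hi hi' => ?_, ?_, hz'⟩, ?_⟩
          · rcases eq_or_lt_of_le hi' with h | h
            · rwa [h]
            · by_contra hc
              refine hmin (z - 1 - i) (by omega) ⟨by omega, ?_, by omega⟩
              rwa [show z - 1 - (z - 1 - i) = i by omega]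
          · rw [show z - k - 1 = z - 1 - k by omega]
            exact hk.2.1
          · simp only [g]
            rw [if_neg (by omega)]
    · rintro (⟨i, hi, rfl⟩ | ⟨⟨a, b⟩, hp, rfl⟩)
      · have := hHm i hi
        simp only [f]
        split_ifs with hc
        · exact ⟨⟨by omega, by omega⟩, this.2.1⟩
        · exact ⟨⟨by omega, by omega⟩, this.1⟩
      · obtain ⟨⟨v1, v2, v3⟩, z, e1, e2⟩ := (mem_FPstar_pseudo_iff hR _ _).1 hp
        simp only [g]
        split_ifs with hc
        · exact ⟨⟨by omega, by omega⟩, z _ le_rfl v2⟩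
        · exact ⟨⟨by omega, by omega⟩, z _ v2 le_rfl⟩
  rw [normFP_pseudo_eq_card hR, hun, card_union_of_disjoint hd, card_image_of_injOn hf,
    card_image_of_injOn hg, Set.ncard_eq_toFinset_card _ hfin]

open Finset in
/-- The peaks of height at least two are the apexes of the maximal pyramids indexed by `F_P`,
while the remaining peaks are the hills. -/
theorem finsum_peaks (P : DyckPath n) :
    (∑ᶠ t ∈ {t : ℕ | IsPeak P t}, P.h t) =
      ∑ p ∈ P.finite_FP.toFinset, ((p.2 : ℤ) - p.1 + 2) +
        #{i ∈ range n | P.h (2 * i) = 0 ∧ P.h (2 * (i + 1)) = 0} := by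
  classical
  set H := {i ∈ range n | P.h (2 * i) = 0 ∧ P.h (2 * (i + 1)) = 0} with hH
  have hHm : ∀ i ∈ H, P.h (2 * i) = 0 ∧ P.h (2 * (i + 1)) = 0 ∧ P.h (2 * i + 1) = 1 ∧ i < n := by
    intro i hi
    simp only [hH, mem_filter, mem_range] at hi
    have h1 := P.nonneg (2 * i + 1)
    have h2 := P.step (2 * i) (by omega)
    refine ⟨hi.2.1, hi.2.2, ?_, hi.1⟩
    omega
  have hFm : ∀ p ∈ P.finite_FP.toFinset,
      p.1 ≤ p.2 ∧ IsPeak P (p.1 + p.2) ∧ P.h (p.1 + p.2) = p.2 - p.1 + 2 := by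
    rintro ⟨a, b⟩ hp
    rw [Set.Finite.mem_toFinset] at hp
    exact (P.mem_FP_iff a b).1 hp
  have hset : {t : ℕ | IsPeak P t} =
      ((P.finite_FP.toFinset.image (fun p => p.1 + p.2) ∪ H.image (fun i => 2 * i + 1) :
        Finset ℕ) : Set ℕ) := by
    ext t
    simp only [Set.mem_ofPred_eq, Finset.mem_coe, Finset.mem_union, Finset.mem_image]
    constructor
    · intro hpk
      obtain ⟨p1, p2, p3, p4⟩ := id hpk
      have hn := P.nonneg (t - 1)
      have hn' := P.nonneg (t + 1)
      have hpar := P.h_emod_two t (by omega)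
      have hl := P.h_le_self t
      rcases eq_or_lt_of_le (show 1 ≤ P.h t by omega) with h | h
      · refine Or.inr ⟨t / 2, ?_, by omega⟩
        simp only [hH, mem_filter, mem_range]
        rw [show 2 * (t / 2) = t - 1 by omega, show 2 * (t / 2 + 1) = t + 1 by omega]
        omega
      · obtain ⟨k, hk⟩ := Int.eq_ofNat_of_zero_le (P.nonneg t)
        refine Or.inl ⟨((t + 2 - k) / 2, (t + k - 2) / 2), ?_, by omega⟩
        rw [Set.Finite.mem_toFinset, mem_FP_iff,
          show (t + 2 - k) / 2 + (t + k - 2) / 2 = t by omega]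
        exact ⟨by omega, hpk, by omega⟩
    · rintro (⟨p, hp, rfl⟩ | ⟨i, hi, rfl⟩)
      · exact (hFm p hp).2.1
      · have h := hHm i hi
        have e : P.h (2 * i + 1 + 1) = 0 := h.2.1
        refine ⟨by omega, by omega, ?_, ?_⟩
        · rw [show 2 * i + 1 - 1 = 2 * i by omega]
          omega
        · omega
  have hd : Disjoint (P.finite_FP.toFinset.image (fun p => p.1 + p.2))
      (H.image (fun i => 2 * i + 1)) := by
    rw [Finset.disjoint_left]
    intro x hx hy
    rw [Finset.mem_image] at hx hy
    obtain ⟨p, hp, rfl⟩ := hx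
    obtain ⟨i, hi, hpi⟩ := hy
    have h1 := hFm p hp
    have h2 := hHm i hi
    rw [hpi] at h2
    omega
  rw [hset, finsum_mem_coe_finset, sum_union hd, sum_image, sum_image]
  · congr 1
    · exact sum_congr rfl fun p hp => (hFm p hp).2.2
    · rw [sum_congr rfl fun i hi => (hHm i hi).2.2.1]
      simp
  · intro i _ j _ hij
    simp only at hij
    omega
  · intro p hp q hq hpq
    have h1 := hFm p hp
    have h2 := hFm q hq
    simp only at hpq
    rw [← hpq] at h2
    ext <;> omega

end DyckPath

/-- For `P ≠ (ud)^n` with pseudocomplement `∼P = R`, if the intervals in `F_P` are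
pairwise disjoint, then the sum of the heights of the peaks of `P` equals
`‖F_P‖ + |F_P| + ‖F_{∼P}‖ − |F_{∼P}*|`, which also equals `(n−1) + |F_P| − |F_{∼P}*|`. -/
theorem sum_peak_heights_eq (n : ℕ) (P R : DyckPath n) (hP : P ≠ minPath n)
    (hR : IsPseudo P R)
    (hdisj : ∀ p ∈ FP P, ∀ q ∈ FP P, p ≠ q →
      Set.Icc p.1 p.2 ∩ Set.Icc q.1 q.2 = ∅) :
    (∑ᶠ t ∈ {t : ℕ | IsPeak P t}, P.h t) =
      (normFP P : ℤ) + ((FP P).ncard : ℤ) + (normFP R : ℤ) - ((FPstar R).ncard : ℤ) ∧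
    (∑ᶠ t ∈ {t : ℕ | IsPeak P t}, P.h t) =
      ((n : ℤ) - 1) + ((FP P).ncard : ℤ) - ((FPstar R).ncard : ℤ) := by
  have hsum : ∑ p ∈ P.finite_FP.toFinset, ((p.2 : ℤ) - p.1 + 2) =
      (normFP P : ℤ) + ((FP P).ncard : ℤ) := by
    rw [← P.sum_card_FP hdisj, Set.ncard_eq_toFinset_card _ P.finite_FP, Finset.card_eq_sum_ones]
    push_cast
    rw [← Finset.sum_add_distrib]
    refine Finset.sum_congr rfl fun p hp => ?_
    rw [Set.Finite.mem_toFinset] at hp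
    have := hp.1.2.1
    omega
  have hhills := DyckPath.card_hills_add_card_FPstar hP hR
  have hnorm : normFP P + normFP R = n - 1 := by
    rw [P.normFP_eq_card, DyckPath.normFP_pseudo_eq_card hR, add_comm,
      Finset.card_filter_add_card_filter_not]
    simp
  have hn : 1 ≤ n := by
    by_contra hc
    exact hP (P.eq_minPath_of_forall fun i h1 h2 => by omega)
  rw [P.finsum_peaks, hsum]
  constructor <;> omega
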